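/- Fix k ≥ 3 and w ∈ S_n. Every inversion of w lies in exactly one occurrence of the pattern w_0^{(k)} = k(k−1)···21 (i.e., for every pair of positions i < j with w(i) > w(j) there is exactly one k-element set of positions containing both i and j on which w is decreasing) if and only if there exist a reduced decomposition j of w_0^{(k)} and pairwise distinct nonnegative integers M_1,...,M_r such that the concatenation j^{M_1}···j^{M_r} is a reduced decomposition of w. Moreover, in that case |M_i − M_j| ≥ k−1 for all i ≠ j, and w has exactly r occurrences of the pattern w_0^{(k)}. -/

import Mathlib

namespace Paper

/-! ### Type A: the symmetric group `S_n` as `Equiv.Perm (Fin n)` -/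

/-- The simple transposition `s_i ∈ S_n` (1-indexed letter `i`, meaningful for
`1 ≤ i ≤ n-1`): it interchanges the entries in (1-indexed) positions `i` and `i+1`,
i.e. (0-indexed) positions `i-1` and `i` of `Fin n`. Out-of-range letters give `1`. -/
def sA (n : ℕ) (i : ℕ) : Equiv.Perm (Fin n) :=
  if h : 1 ≤ i ∧ i < n then Equiv.swap ⟨i - 1, by omega⟩ ⟨i, h.2⟩ else 1

/-- The product `s_{i_1} ⋯ s_{i_ℓ}` of a word `i_1 ⋯ i_ℓ`. -/
def prodA (n : ℕ) (w : List ℕ) : Equiv.Perm (Fin n) := (w.map (sA n)).prod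

/-- A word in the letters `{1, …, n-1}`. -/
def IsWordA (n : ℕ) (w : List ℕ) : Prop := ∀ i ∈ w, 1 ≤ i ∧ i ≤ n - 1

/-- `w` is a reduced decomposition of `x ∈ S_n`. -/
def ReducedA (n : ℕ) (w : List ℕ) (x : Equiv.Perm (Fin n)) : Prop :=
  IsWordA n w ∧ prodA n w = x ∧
    ∀ w' : List ℕ, IsWordA n w' → prodA n w' = x → w.length ≤ w'.length

/-- The Coxeter length `ℓ(x)`: minimal length of a word for `x`. -/
noncomputable def lenA (n : ℕ) (x : Equiv.Perm (Fin n)) : ℕ :=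
  sInf {l | ∃ w : List ℕ, IsWordA n w ∧ prodA n w = x ∧ w.length = l}

/-- Bruhat order on `S_n`: `v ≤ w` iff some reduced decomposition of `v` is a
(not necessarily consecutive) subword of some reduced decomposition of `w`. -/
def bruhatA (n : ℕ) (v w : Equiv.Perm (Fin n)) : Prop :=
  ∃ a b : List ℕ, ReducedA n a v ∧ ReducedA n b w ∧ a.Sublist b

/-- `w ∈ S_n` is boolean: the principal order ideal `B(w)`, ordered by the Bruhat
order, is order-isomorphic to the lattice of all subsets of `{1,…,r}` for some `r`. -/
def BooleanA (n : ℕ) (w : Equiv.Perm (Fin n)) : Prop :=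
  ∃ (r : ℕ) (e : {v : Equiv.Perm (Fin n) // bruhatA n v w} ≃ Finset (Fin r)),
    ∀ a b : {v : Equiv.Perm (Fin n) // bruhatA n v w}, bruhatA n a.1 b.1 ↔ e a ⊆ e b

/-- Pattern containment: `w ∈ S_n` contains `p ∈ S_k`. -/
def ContainsA {n k : ℕ} (w : Equiv.Perm (Fin n)) (p : Equiv.Perm (Fin k)) : Prop :=
  ∃ f : Fin k → Fin n, StrictMono f ∧ ∀ a b : Fin k, w (f a) < w (f b) ↔ p a < p b

/-- Pattern avoidance. -/
def AvoidsA {n k : ℕ} (w : Equiv.Perm (Fin n)) (p : Equiv.Perm (Fin k)) : Prop :=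
  ¬ ContainsA w p

/-- The pattern `321` (one-line notation). -/
def p321 : Equiv.Perm (Fin 3) := ⟨![2,1,0], ![2,1,0], by decide, by decide⟩
/-- The pattern `231` (one-line notation). -/
def p231 : Equiv.Perm (Fin 3) := ⟨![1,2,0], ![2,0,1], by decide, by decide⟩
/-- The pattern `312` (one-line notation). -/
def p312 : Equiv.Perm (Fin 3) := ⟨![2,0,1], ![1,2,0], by decide, by decide⟩
/-- The pattern `3412` (one-line notation). -/
def p3412 : Equiv.Perm (Fin 4) := ⟨![2,3,0,1], ![2,3,0,1], by decide, by decide⟩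

/-- The longest (decreasing) permutation `w_0^{(k)} = k (k-1) ⋯ 2 1 ∈ S_k`. -/
def w0 (k : ℕ) : Equiv.Perm (Fin k) := Fin.revPerm

/-- The shift of a word by `M`: each letter `i` becomes `i + M`. -/
def shift (M : ℕ) (w : List ℕ) : List ℕ := w.map (· + M)




/-! ### Types B and D: signed permutations, modelled as permutations `w` of `ℤ`
with `w(-x) = -w(x)` that fix all integers of absolute value `> n`. -/

/-- The simple generators of `S_n^B`, as permutations of `ℤ`:
`sB 0` negates the value `1`; for `i ≥ 1`, `sB i` interchanges the values
`i` and `i+1` (and `-i` and `-(i+1)`). -/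
def sB : ℕ → Equiv.Perm ℤ
  | 0 => Equiv.swap 1 (-1)
  | (i+1) => Equiv.swap ((i : ℤ) + 1) ((i : ℤ) + 2) * Equiv.swap (-((i : ℤ) + 1)) (-((i : ℤ) + 2))

/-- The simple generators of `S_n^D`: letter `0` encodes `s_{1'} = s_0 s_1 s_0`
(mapping `1 ↦ -2` and `2 ↦ -1`), and letters `i ≥ 1` are as in type `B`. -/
def sD : ℕ → Equiv.Perm ℤ
  | 0 => sB 0 * sB 1 * sB 0
  | (i+1) => sB (i+1)

def prodB (w : List ℕ) : Equiv.Perm ℤ := (w.map sB).prod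
def prodD (w : List ℕ) : Equiv.Perm ℤ := (w.map sD).prod

/-- A word in the type `B`/`D` letters `{0, 1, …, n-1}`. -/
def IsWordBD (n : ℕ) (w : List ℕ) : Prop := ∀ i ∈ w, i ≤ n - 1

/-- `w` is a reduced decomposition of `x ∈ S_n^B`. -/
def ReducedB (n : ℕ) (w : List ℕ) (x : Equiv.Perm ℤ) : Prop :=
  IsWordBD n w ∧ prodB w = x ∧
    ∀ w' : List ℕ, IsWordBD n w' → prodB w' = x → w.length ≤ w'.length

/-- `w` is a reduced decomposition of `x ∈ S_n^D`. -/
def ReducedD (n : ℕ) (w : List ℕ) (x : Equiv.Perm ℤ) : Prop :=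
  IsWordBD n w ∧ prodD w = x ∧
    ∀ w' : List ℕ, IsWordBD n w' → prodD w' = x → w.length ≤ w'.length

/-- Length in `S_n^B`. -/
noncomputable def lenB (n : ℕ) (x : Equiv.Perm ℤ) : ℕ :=
  sInf {l | ∃ w : List ℕ, IsWordBD n w ∧ prodB w = x ∧ w.length = l}

/-- Length in `S_n^D`. -/
noncomputable def lenD (n : ℕ) (x : Equiv.Perm ℤ) : ℕ :=
  sInf {l | ∃ w : List ℕ, IsWordBD n w ∧ prodD w = x ∧ w.length = l}

/-- Bruhat order on `S_n^B`. -/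
def bruhatB (n : ℕ) (v w : Equiv.Perm ℤ) : Prop :=
  ∃ a b : List ℕ, ReducedB n a v ∧ ReducedB n b w ∧ a.Sublist b

/-- Bruhat order on `S_n^D`. -/
def bruhatD (n : ℕ) (v w : Equiv.Perm ℤ) : Prop :=
  ∃ a b : List ℕ, ReducedD n a v ∧ ReducedD n b w ∧ a.Sublist b

/-- `w` is an element of `S_n^B`: an "odd" permutation of `{±1, …, ±n}`. -/
def IsSignedPerm (n : ℕ) (w : Equiv.Perm ℤ) : Prop :=
  (∀ x : ℤ, w (-x) = - w x) ∧ ∀ x : ℤ, (n : ℤ) < |x| → w x = x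

/-- `w` is an element of `S_n^D`: a signed permutation with an even number of
negative values in its one-line notation. -/
def IsTypeD (n : ℕ) (w : Equiv.Perm ℤ) : Prop :=
  IsSignedPerm n w ∧ Even (((Finset.Icc (1 : ℤ) n).filter (fun x => w x < 0)).card)

/-- `w ∈ S_n^B` is boolean (for the type `B` Bruhat order). -/
def BooleanB (n : ℕ) (w : Equiv.Perm ℤ) : Prop :=
  ∃ (r : ℕ) (e : {v : Equiv.Perm ℤ // bruhatB n v w} ≃ Finset (Fin r)),
    ∀ a b : {v : Equiv.Perm ℤ // bruhatB n v w}, bruhatB n a.1 b.1 ↔ e a ⊆ e b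

/-- `w ∈ S_n^D` is boolean (for the type `D` Bruhat order). -/
def BooleanD (n : ℕ) (w : Equiv.Perm ℤ) : Prop :=
  ∃ (r : ℕ) (e : {v : Equiv.Perm ℤ // bruhatD n v w} ≃ Finset (Fin r)),
    ∀ a b : {v : Equiv.Perm ℤ // bruhatD n v w}, bruhatD n a.1 b.1 ↔ e a ⊆ e b

/-- Signed pattern containment, where the pattern is given by its one-line
notation `p` (a list of nonzero integers): there are positions
`1 ≤ f 0 < ⋯ < f (k-1) ≤ n` such that each `w (f j)` has the same sign as the
`j`-th entry of `p`, and the absolute values appear in the same relative order. -/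
def containsPat (n : ℕ) (w : Equiv.Perm ℤ) (p : List ℤ) : Prop :=
  ∃ f : Fin p.length → ℤ, StrictMono f ∧ (∀ j, 1 ≤ f j ∧ f j ≤ (n : ℤ)) ∧
    (∀ j, 0 < w (f j) ↔ 0 < p.get j) ∧
    (∀ j j', |w (f j)| < |w (f j')| ↔ |p.get j| < |p.get j'|)

/-- Signed pattern avoidance. -/
def avoidsPat (n : ℕ) (w : Equiv.Perm ℤ) (p : List ℤ) : Prop := ¬ containsPat n w p


/-! ### Extra definitions used in some statements -/

/-- `w ∈ S_n` is decomposable: `B(w) ≅ B(u) × B(v)` (as posets under Bruhat order)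
for some `u ∈ S_m`, `v ∈ S_{m'}` with `m, m' < n`. -/
def Decomposable (n : ℕ) (w : Equiv.Perm (Fin n)) : Prop :=
  ∃ (m m' : ℕ), m < n ∧ m' < n ∧
    ∃ (u : Equiv.Perm (Fin m)) (v : Equiv.Perm (Fin m'))
      (e : {x : Equiv.Perm (Fin n) // bruhatA n x w} ≃
        {y : Equiv.Perm (Fin m) // bruhatA m y u} × {z : Equiv.Perm (Fin m') // bruhatA m' z v}),
      ∀ a b : {x : Equiv.Perm (Fin n) // bruhatA n x w},
        bruhatA n a.1 b.1 ↔
          (bruhatA m ((e a).1).1 ((e b).1).1 ∧ bruhatA m' ((e a).2).1 ((e b).2).1)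

/-- `w` is decreasing on the set of positions `T`. -/
def DecrOn (n : ℕ) (w : Equiv.Perm (Fin n)) (T : Finset (Fin n)) : Prop :=
  ∀ a ∈ T, ∀ b ∈ T, a < b → w b < w a

/-- Every inversion of `w` lies in exactly one occurrence of the decreasing
pattern `w_0^{(k)}`: for every `i < j` with `w i > w j` there is exactly one
`k`-element set of positions containing `i` and `j` on which `w` is decreasing. -/
def EveryInvOnce (n k : ℕ) (w : Equiv.Perm (Fin n)) : Prop :=
  ∀ i j : Fin n, i < j → w j < w i →
    ∃! T : Finset (Fin n), T.card = k ∧ DecrOn n w T ∧ i ∈ T ∧ j ∈ T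

/-- Equality of two patterns of (possibly a priori different) sizes. -/
def EqPat {k m : ℕ} (p : Equiv.Perm (Fin k)) (q : Equiv.Perm (Fin m)) : Prop :=
  ∃ h : k = m, ∀ i : Fin k, ((p i : ℕ) = (q (Fin.cast h i) : ℕ))

/-- `L(n,k)`: the number of boolean permutations in `S_n` of length `k`. -/
noncomputable def LA (n k : ℕ) : ℕ :=
  Nat.card {w : Equiv.Perm (Fin n) // BooleanA n w ∧ lenA n w = k}

/-- `L` extended to integer arguments, with the convention that it vanishes
when `m < 1` or `j < 0`. -/
noncomputable def Lz (m j : ℤ) : ℤ :=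
  if 1 ≤ m ∧ 0 ≤ j then (LA m.toNat j.toNat : ℤ) else 0

/-- `L^D(n,k)`: the number of boolean elements of `S_n^D` of length `k`. -/
noncomputable def LD (n k : ℕ) : ℕ :=
  Nat.card {w : Equiv.Perm ℤ // IsTypeD n w ∧ BooleanD n w ∧ lenD n w = k}


/-! ### Inversion graph -/

section Helpers

open Equiv

variable {n : ℕ}

/-- Adjacency in the inversion graph. -/
def IAdj (w : Perm (Fin n)) (x y : Fin n) : Prop := ¬ (x < y ↔ w x < w y)

open Classical in
/-- All ordered pairs adjacent in the inversion graph. -/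
noncomputable def invD (w : Perm (Fin n)) : Finset (Fin n × Fin n) :=
  Finset.univ.filter (fun p => IAdj w p.1 p.2)

lemma mem_invD (w : Perm (Fin n)) (x y : Fin n) : (x, y) ∈ invD w ↔ IAdj w x y := by
  simp [invD]

lemma IAdj.ne {w : Perm (Fin n)} {x y : Fin n} (h : IAdj w x y) : x ≠ y := by
  rintro rfl; simp [IAdj] at h

lemma iadj_cases {w : Perm (Fin n)} {x y : Fin n} :
    IAdj w x y ↔ (x < y ∧ w y < w x) ∨ (y < x ∧ w x < w y) := by
  unfold IAdj
  by_cases h : x = y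
  · subst h; simp
  · have h2 : w x ≠ w y := fun h' => h (w.injective h')
    constructor
    · intro h'
      rcases lt_or_gt_of_ne h with h3 | h3 <;> rcases lt_or_gt_of_ne h2 with h4 | h4
      · exact absurd ⟨fun _ => h4, fun _ => h3⟩ h'
      · exact Or.inl ⟨h3, h4⟩
      · exact Or.inr ⟨h3, h4⟩
      · exact absurd ⟨fun h => absurd h (not_lt.2 h3.le), fun h => absurd h (not_lt.2 h4.le)⟩ h'
    · rintro (⟨h3, h4⟩ | ⟨h3, h4⟩) h5
      · exact absurd (h5.1 h3) (not_lt.2 h4.le)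
      · exact absurd (h5.2 h4) (not_lt.2 h3.le)

lemma IAdj.symm {w : Perm (Fin n)} {x y : Fin n} (h : IAdj w x y) : IAdj w y x := by
  rw [iadj_cases] at h ⊢; tauto

lemma iadj_of_lt {w : Perm (Fin n)} {x y : Fin n} (h : x < y) (h' : w y < w x) : IAdj w x y :=
  iadj_cases.2 (Or.inl ⟨h, h'⟩)

lemma iadj_mul (u v : Perm (Fin n)) (x y : Fin n) :
    IAdj (u * v) x y ↔ ¬ (IAdj v x y ↔ IAdj u (v x) (v y)) := by
  simp only [IAdj, Perm.mul_apply]; tauto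

lemma decrOn_iff (w : Perm (Fin n)) (T : Finset (Fin n)) :
    DecrOn n w T ↔ ∀ a ∈ T, ∀ b ∈ T, a ≠ b → IAdj w a b := by
  constructor
  · intro h a ha b hb hab
    rcases lt_or_gt_of_ne hab with h1 | h1
    · exact iadj_cases.2 (Or.inl ⟨h1, h a ha b hb h1⟩)
    · exact iadj_cases.2 (Or.inr ⟨h1, h b hb a ha h1⟩)
  · intro h a ha b hb hab
    rcases iadj_cases.1 (h a ha b hb hab.ne) with h1 | h1
    · exact h1.2
    · exact absurd h1.1 (not_lt.2 hab.le)

lemma everyInvOnce_iff (k : ℕ) (w : Perm (Fin n)) :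
    EveryInvOnce n k w ↔ ∀ x y, IAdj w x y →
      ∃! T : Finset (Fin n), T.card = k ∧ DecrOn n w T ∧ x ∈ T ∧ y ∈ T := by
  constructor
  · intro h x y hxy
    rcases iadj_cases.1 hxy with h1 | h1
    · exact h x y h1.1 h1.2
    · obtain ⟨T, hT, hT'⟩ := h y x h1.1 h1.2
      exact ⟨T, ⟨hT.1, hT.2.1, hT.2.2.2, hT.2.2.1⟩,
        fun S hS => hT' S ⟨hS.1, hS.2.1, hS.2.2.2, hS.2.2.1⟩⟩
  · intro h x y h1 h2
    exact h x y (iadj_of_lt h1 h2)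

open Classical in
/-- Pullback of the inversion pairs of `u` along `v`. -/
noncomputable def pullD (u v : Perm (Fin n)) : Finset (Fin n × Fin n) :=
  Finset.univ.filter (fun p => IAdj u (v p.1) (v p.2))

lemma card_pullD (u v : Perm (Fin n)) : (pullD u v).card = (invD u).card := by
  apply Finset.card_bij (fun p _ => (v p.1, v p.2))
  · rintro ⟨a, b⟩ h; simpa [pullD, invD] using h
  · rintro ⟨a, b⟩ _ ⟨c, d⟩ _ h; simpa using h
  · rintro ⟨a, b⟩ h
    exact ⟨(v⁻¹ a, v⁻¹ b), by simpa [pullD, invD] using h, by simp⟩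

lemma invD_mul (u v : Perm (Fin n)) : invD (u * v) = symmDiff (invD v) (pullD u v) := by
  ext ⟨x, y⟩
  simp only [mem_invD, Finset.mem_symmDiff, iadj_mul, pullD, Finset.mem_filter, Finset.mem_univ,
    true_and]
  tauto

lemma card_mul_aux (u v : Perm (Fin n)) :
    (invD (u * v)).card + 2 * (invD v ∩ pullD u v).card = (invD u).card + (invD v).card := by
  rw [← card_pullD u v, invD_mul]
  have h1 : symmDiff (invD v) (pullD u v) = (invD v \ pullD u v) ∪ (pullD u v \ invD v) := rfl
  rw [h1, Finset.card_union_of_disjoint (disjoint_sdiff_sdiff)]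
  have h2 := Finset.card_sdiff_add_card_inter (invD v) (pullD u v)
  have h3 := Finset.card_sdiff_add_card_inter (pullD u v) (invD v)
  rw [Finset.inter_comm] at h3
  omega

lemma card_mul_le (u v : Perm (Fin n)) :
    (invD (u * v)).card ≤ (invD u).card + (invD v).card := by
  have := card_mul_aux u v; omega

/-- The product is length-additive iff no pair is inverted twice. -/
lemma card_mul_iff (u v : Perm (Fin n)) :
    (invD (u * v)).card = (invD u).card + (invD v).card ↔
      ∀ x y, IAdj v x y → ¬ IAdj u (v x) (v y) := by
  have := card_mul_aux u v
  have h : (invD v ∩ pullD u v).card = 0 ↔ ∀ x y, IAdj v x y → ¬ IAdj u (v x) (v y) := by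
    rw [Finset.card_eq_zero, Finset.eq_empty_iff_forall_notMem]
    constructor
    · intro h x y h1 h2
      exact h (x, y) (by simp [mem_invD, pullD, h1, h2])
    · rintro h ⟨x, y⟩ h1
      simp only [Finset.mem_inter, mem_invD, pullD, Finset.mem_filter, Finset.mem_univ,
        true_and] at h1
      exact h x y h1.1 h1.2
  rw [← h]; omega

lemma invD_one : invD (1 : Perm (Fin n)) = ∅ := by
  ext ⟨x, y⟩; simp [mem_invD, IAdj]

lemma eq_one_of_no_adj (w : Perm (Fin n)) (h : ∀ x y, ¬ IAdj w x y) : w = 1 := by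
  let e : Fin n ≃o Fin n := ⟨w, by
    intro a b
    have := h b a
    unfold IAdj at this
    rw [not_not] at this
    rw [← not_lt, ← not_lt, this]⟩
  have he : e = OrderIso.refl _ := Subsingleton.elim _ _
  ext x
  have : e x = x := by rw [he]; rfl
  exact congrArg Fin.val this

/-! ### Block reversals -/

/-- Underlying function of the block reversal. -/
def revFun (n k M : ℕ) (x : Fin n) : Fin n :=
  if h : M + k ≤ n ∧ M ≤ x.val ∧ x.val < M + k then ⟨2 * M + k - 1 - x.val, by omega⟩ else x

lemma revFun_val (n k M : ℕ) (x : Fin n) : (revFun n k M x).val =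
    if M + k ≤ n ∧ M ≤ x.val ∧ x.val < M + k then 2 * M + k - 1 - x.val else x.val := by
  unfold revFun; split_ifs <;> rfl

lemma revFun_invol (n k M : ℕ) : Function.Involutive (revFun n k M) := by
  intro x
  apply Fin.ext
  rw [revFun_val, revFun_val]
  split_ifs <;> omega

/-- Reversal of the positions `M, …, M+k-1`. -/
def revB (n k M : ℕ) : Perm (Fin n) := (revFun_invol n k M).toPerm

lemma revB_val (n k M : ℕ) (x : Fin n) : (revB n k M x).val =
    if M + k ≤ n ∧ M ≤ x.val ∧ x.val < M + k then 2 * M + k - 1 - x.val else x.val :=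
  revFun_val n k M x

lemma revB_revB (n k M : ℕ) (x : Fin n) : revB n k M (revB n k M x) = x :=
  revFun_invol n k M x

lemma revB_mul_self (n k M : ℕ) : revB n k M * revB n k M = 1 := by
  ext x; simp [revB_revB]

lemma iadj_revB {k M : ℕ} (h : M + k ≤ n) (x y : Fin n) : IAdj (revB n k M) x y ↔
    x ≠ y ∧ (M ≤ x.val ∧ x.val < M + k) ∧ (M ≤ y.val ∧ y.val < M + k) := by
  unfold IAdj
  rw [Fin.lt_def, Fin.lt_def, revB_val, revB_val, ne_eq, Fin.ext_iff]
  split_ifs <;> omega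

/-- The interval `M, …, M+k-1`. -/
def blk (n k M : ℕ) : Finset (Fin n) := Finset.univ.filter (fun x => M ≤ x.val ∧ x.val < M + k)

lemma mem_blk {k M : ℕ} {x : Fin n} : x ∈ blk n k M ↔ M ≤ x.val ∧ x.val < M + k := by
  simp [blk]

lemma card_blk {k M : ℕ} (h : M + k ≤ n) : (blk n k M).card = k := by
  have : (blk n k M).card = (Finset.Ico M (M + k)).card := by
    apply Finset.card_bij (fun x _ => x.val)
    · intro x hx; simpa [mem_blk] using hx
    · intro x _ y _ h; exact Fin.ext h
    · intro b hb
      rw [Finset.mem_Ico] at hb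
      exact ⟨⟨b, by omega⟩, by simpa [mem_blk] using hb, rfl⟩
  simpa using this

lemma invD_revB {k M : ℕ} (h : M + k ≤ n) : invD (revB n k M) = (blk n k M).offDiag := by
  ext ⟨x, y⟩
  rw [mem_invD, iadj_revB h, Finset.mem_offDiag, mem_blk, mem_blk]
  tauto

lemma card_invD_revB {k M : ℕ} (h : M + k ≤ n) : (invD (revB n k M)).card = k * (k - 1) := by
  rw [invD_revB h, Finset.offDiag_card, card_blk h, Nat.mul_sub, mul_one]

lemma sA_eq {c : ℕ} (h : 1 ≤ c ∧ c < n) : sA n c = revB n 2 (c - 1) := by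
  ext x
  rw [revB_val, sA, dif_pos h, Equiv.swap_apply_def]
  simp only [Fin.ext_iff]
  split_ifs <;> simp <;> omega

lemma w0_eq (k : ℕ) : w0 k = revB k k 0 := by
  ext x
  rw [revB_val]
  simp [w0, Fin.val_rev]
  omega

lemma card_sA_le (c : ℕ) : (invD (sA n c)).card ≤ 2 := by
  by_cases h : 1 ≤ c ∧ c < n
  · rw [sA_eq h, card_invD_revB (by omega)]
  · rw [sA, dif_neg h, invD_one]; simp

lemma card_prodA_le (l : List ℕ) : (invD (prodA n l)).card ≤ 2 * l.length := by
  induction l with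
  | nil => simp [prodA, invD_one]
  | cons c l ih =>
    have h : prodA n (c :: l) = sA n c * prodA n l := by simp [prodA]
    rw [h, List.length_cons]
    have h1 := card_mul_le (sA n c) (prodA n l)
    have h2 := card_sA_le (n := n) c
    omega

lemma prodA_append (l m : List ℕ) : prodA n (l ++ m) = prodA n l * prodA n m := by
  simp [prodA]

lemma exists_descent (w : Perm (Fin n)) : ∀ (d : ℕ) (x y : Fin n), y.val = x.val + d → x < y →
    w y < w x → ∃ p q : Fin n, q.val = p.val + 1 ∧ w q < w p := by
  intro d
  induction d with
  | zero => intro x y h1 h2; rw [Fin.lt_def] at h2; omega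
  | succ d ih =>
    intro x y h1 h2 h3
    by_cases hd : d = 0
    · exact ⟨x, y, by omega, h3⟩
    · have hm : x.val + 1 < n := by omega
      by_cases h4 : w ⟨x.val + 1, hm⟩ < w x
      · exact ⟨x, ⟨x.val + 1, hm⟩, rfl, h4⟩
      · apply ih ⟨x.val + 1, hm⟩ y (by simp; omega) (by rw [Fin.lt_def]; simp; omega)
        exact lt_of_lt_of_le h3 (not_lt.1 h4)

/-- Splitting off a right block of consecutive positions on which `w` is decreasing. -/
lemma split_block {k p : ℕ} (w : Perm (Fin n)) (hp : p + k ≤ n)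
    (hd : DecrOn n w (blk n k p)) :
    (∀ x y, IAdj (w * revB n k p) (revB n k p x) (revB n k p y) ↔
      IAdj w x y ∧ ¬ (x ∈ blk n k p ∧ y ∈ blk n k p)) ∧
    (invD w).card = (invD (w * revB n k p)).card + k * (k - 1) := by
  have hw : w = (w * revB n k p) * revB n k p := by rw [mul_assoc, revB_mul_self, mul_one]
  have h1 : ∀ x y, IAdj (w * revB n k p) (revB n k p x) (revB n k p y) ↔
      IAdj w x y ∧ ¬ (x ∈ blk n k p ∧ y ∈ blk n k p) := by
    intro x y
    have h2 := iadj_mul (w * revB n k p) (revB n k p) x y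
    rw [← hw] at h2
    have h3 := iadj_revB hp x y
    rw [← mem_blk, ← mem_blk] at h3
    have h4 := (decrOn_iff w _).1 hd x
    have h4' : x ∈ blk n k p → y ∈ blk n k p → x ≠ y → IAdj w x y := fun a b c => h4 a y b c
    by_cases hxy : x = y
    · subst hxy; simp [IAdj]
    · clear hw
      rw [h2, h3]
      rw [h2, h3] at h4'
      clear h2 h3 h4 hd
      generalize IAdj (w * revB n k p) (revB n k p x) (revB n k p y) = A at *
      generalize (x ∈ blk n k p) = B at *
      generalize (y ∈ blk n k p) = C at *
      by_cases B <;> by_cases C <;> by_cases A <;> simp_all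
  refine ⟨h1, ?_⟩
  have h5 := (card_mul_iff (w * revB n k p) (revB n k p)).2 ?_
  · rw [← hw, card_invD_revB hp] at h5; exact h5
  · intro x y hxy
    rw [h1]
    rw [iadj_revB hp, ← mem_blk, ← mem_blk] at hxy
    tauto

lemma exists_word (N : ℕ) : ∀ w : Perm (Fin n), (invD w).card = N →
    ∃ l, IsWordA n l ∧ prodA n l = w ∧ 2 * l.length = (invD w).card := by
  induction N using Nat.strong_induction_on with
  | _ N ih =>
    intro w hN
    by_cases h : ∀ x y, ¬ IAdj w x y
    · refine ⟨[], by simp [IsWordA], ?_, ?_⟩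
      · rw [eq_one_of_no_adj w h]; simp [prodA]
      · rw [eq_one_of_no_adj w h, invD_one]; simp
    · push Not at h
      obtain ⟨x, y, hxy⟩ := h
      have : ∃ x y, x < y ∧ w y < w x := by
        rcases iadj_cases.1 hxy with h1 | h1
        · exact ⟨x, y, h1⟩
        · exact ⟨y, x, h1⟩
      obtain ⟨x, y, h1, h2⟩ := this
      obtain ⟨p, q, hq, hpq⟩ := exists_descent w (y.val - x.val) x y
        (by rw [Fin.lt_def] at h1; omega) h1 h2
      have hp : p.val + 2 ≤ n := by omega
      obtain ⟨_, h4⟩ := split_block (k := 2) (p := p.val) w hp (by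
        intro a ha b hb hab
        rw [mem_blk] at ha hb
        rw [Fin.lt_def] at hab
        have e1 : a = p := Fin.ext (by omega)
        have e2 : b = q := Fin.ext (by omega)
        rw [e1, e2]; exact hpq)
      obtain ⟨l, hl1, hl2, hl3⟩ := ih _ (by omega) (w * revB n 2 p.val) rfl
      refine ⟨l ++ [p.val + 1], ?_, ?_, ?_⟩
      · intro i hi
        rw [List.mem_append, List.mem_singleton] at hi
        rcases hi with hi | hi
        · exact hl1 i hi
        · omega
      · have h5 : prodA n [p.val + 1] = revB n 2 p.val := by
          simp only [prodA, List.map_cons, List.map_nil, List.prod_singleton]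
          rw [sA_eq (by omega)]; simp
        rw [prodA_append, hl2, h5, mul_assoc, revB_mul_self, mul_one]
      · rw [List.length_append, List.length_singleton]; omega

lemma reducedA_iff (l : List ℕ) (w : Perm (Fin n)) :
    ReducedA n l w ↔ IsWordA n l ∧ prodA n l = w ∧ 2 * l.length = (invD w).card := by
  constructor
  · rintro ⟨h1, h2, h3⟩
    refine ⟨h1, h2, ?_⟩
    obtain ⟨l', a, b, c⟩ := exists_word _ w rfl
    have := h3 l' a b
    have h4 := card_prodA_le (n := n) l
    rw [h2] at h4
    omega
  · rintro ⟨h1, h2, h3⟩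
    refine ⟨h1, h2, fun l' _ hb => ?_⟩
    have h4 := card_prodA_le (n := n) l'
    rw [hb] at h4
    omega

end Helpers

section Blocks

open Equiv

variable {n k : ℕ}

/-- Product of block reversals. -/
def bprod (n k : ℕ) (L : List ℕ) : Perm (Fin n) := (L.map (revB n k)).prod

lemma bprod_cons (M : ℕ) (L : List ℕ) : bprod n k (M :: L) = revB n k M * bprod n k L := by
  simp [bprod]

lemma bprod_append (L L' : List ℕ) : bprod n k (L ++ L') = bprod n k L * bprod n k L' := by
  simp [bprod]

lemma prodA_cons (c : ℕ) (l : List ℕ) : prodA n (c :: l) = sA n c * prodA n l := by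
  simp [prodA]

lemma prodA_fix_last (l : List ℕ) (h : ∀ c ∈ l, c + 1 < k) (x : Fin k) (hx : x.val + 1 = k) :
    prodA k l x = x := by
  induction l with
  | nil => simp [prodA]
  | cons c l ih =>
    rw [prodA_cons, Perm.mul_apply, ih (fun d hd => h d (by simp [hd]))]
    have hc := h c (by simp)
    by_cases h1 : 1 ≤ c ∧ c < k
    · rw [sA_eq h1]
      apply Fin.ext
      rw [revB_val]
      split_ifs <;> omega
    · rw [sA, dif_neg h1]; rfl

lemma prodA_shift (M : ℕ) (h : M + k ≤ n) (l : List ℕ) (hl : IsWordA k l) :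
    (∀ (x : Fin n) (y : Fin k), x.val = M + y.val →
      (prodA n (shift M l) x).val = M + (prodA k l y).val) ∧
    (∀ x : Fin n, ¬ (M ≤ x.val ∧ x.val < M + k) → prodA n (shift M l) x = x) := by
  induction l with
  | nil => simp [prodA, shift]
  | cons c l ih =>
    obtain ⟨ih1, ih2⟩ := ih (fun d hd => hl d (by simp [hd]))
    have hc := hl c (by simp)
    have e : shift M (c :: l) = (c + M) :: shift M l := by simp [shift]
    rw [e]
    constructor
    · intro x y hxy
      rw [prodA_cons, prodA_cons, Perm.mul_apply, Perm.mul_apply, sA_eq (by omega),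
        sA_eq (by omega), revB_val, revB_val, ih1 x y hxy]
      split_ifs <;> omega
    · intro x hx
      rw [prodA_cons, Perm.mul_apply, ih2 x hx, sA_eq (by omega)]
      apply Fin.ext
      rw [revB_val]
      split_ifs <;> omega

lemma prodA_shift_w0 {j : List ℕ} (hj : ReducedA k j (w0 k)) (M : ℕ) (h : M + k ≤ n) :
    prodA n (shift M j) = revB n k M := by
  obtain ⟨h1, h2⟩ := prodA_shift M h j hj.1
  ext x
  rw [revB_val]
  by_cases hx : M ≤ x.val ∧ x.val < M + k
  · rw [if_pos ⟨h, hx⟩, h1 x ⟨x.val - M, by omega⟩ (by simp; omega), hj.2.1, w0_eq, revB_val]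
    simp only
    split_ifs <;> omega
  · rw [if_neg (fun h' => hx h'.2), h2 x hx]

lemma length_w0 {j : List ℕ} (hj : ReducedA k j (w0 k)) : 2 * j.length = k * (k - 1) := by
  have := ((reducedA_iff _ _).1 hj).2.2
  rw [this, w0_eq, card_invD_revB (by omega)]

lemma last_mem_w0 (hk : 3 ≤ k) {j : List ℕ} (hj : ReducedA k j (w0 k)) : k - 1 ∈ j := by
  by_contra hn
  have := prodA_fix_last j (k := k) (fun c hc => by
    have h1 := hj.1 c hc
    have : c ≠ k - 1 := fun h => hn (h ▸ hc)
    omega) ⟨k - 1, by omega⟩ (by simp; omega)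
  rw [hj.2.1, w0_eq, Fin.ext_iff, revB_val] at this
  simp only at this
  split_ifs at this <;> omega

lemma isWord_shift_iff (hk : 3 ≤ k) {j : List ℕ} (hj : ReducedA k j (w0 k)) (M : ℕ) :
    IsWordA n (shift M j) ↔ M + k ≤ n := by
  constructor
  · intro h
    have := h (k - 1 + M) (by simp only [shift, List.mem_map]; exact ⟨k - 1, last_mem_w0 hk hj, rfl⟩)
    omega
  · intro h i hi
    simp only [shift, List.mem_map] at hi
    obtain ⟨a, ha, rfl⟩ := hi
    have := hj.1 a ha
    omega

lemma isWord_flatten (hk : 3 ≤ k) {j : List ℕ} (hj : ReducedA k j (w0 k)) (L : List ℕ) :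
    IsWordA n (L.map (fun M => shift M j)).flatten ↔ ∀ M ∈ L, M + k ≤ n := by
  have : IsWordA n (L.map (fun M => shift M j)).flatten ↔ ∀ M ∈ L, IsWordA n (shift M j) := by
    unfold IsWordA
    constructor
    · intro h M hM i hi
      exact h i (List.mem_flatten.2 ⟨_, List.mem_map.2 ⟨M, hM, rfl⟩, hi⟩)
    · intro h i hi
      obtain ⟨l, hl, hi⟩ := List.mem_flatten.1 hi
      obtain ⟨M, hM, rfl⟩ := List.mem_map.1 hl
      exact h M hM i hi
  rw [this]
  constructor
  · intro h M hM; exact (isWord_shift_iff hk hj M).1 (h M hM)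
  · intro h M hM; exact (isWord_shift_iff hk hj M).2 (h M hM)

lemma prodA_flatten {j : List ℕ} (hj : ReducedA k j (w0 k)) (L : List ℕ)
    (hL : ∀ M ∈ L, M + k ≤ n) :
    prodA n (L.map (fun M => shift M j)).flatten = bprod n k L := by
  induction L with
  | nil => simp [prodA, bprod]
  | cons M L ih =>
    rw [List.map_cons, List.flatten_cons, prodA_append, ih (fun N hN => hL N (by simp [hN])),
      bprod_cons, prodA_shift_w0 hj M (hL M (by simp))]

lemma length_flatten {j : List ℕ} (L : List ℕ) :
    (L.map (fun M => shift M j)).flatten.length = L.length * j.length := by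
  induction L with
  | nil => simp
  | cons M L ih =>
    rw [List.map_cons, List.flatten_cons, List.length_append, ih, List.length_cons]
    simp [shift]; ring

lemma reduced_flatten (hk : 3 ≤ k) {j : List ℕ} (hj : ReducedA k j (w0 k)) (L : List ℕ)
    (w : Perm (Fin n)) :
    ReducedA n (L.map (fun M => shift M j)).flatten w ↔
      (∀ M ∈ L, M + k ≤ n) ∧ bprod n k L = w ∧ (invD w).card = L.length * (k * (k - 1)) := by
  rw [reducedA_iff, isWord_flatten hk hj, length_flatten]
  have e : 2 * (L.length * j.length) = L.length * (k * (k - 1)) := by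
    rw [← length_w0 hj]; ring
  rw [e]
  constructor
  · rintro ⟨h1, h2, h3⟩
    rw [prodA_flatten hj L h1] at h2
    exact ⟨h1, h2, h3.symm⟩
  · rintro ⟨h1, h2, h3⟩
    exact ⟨h1, by rw [prodA_flatten hj L h1, h2], h3.symm⟩

/-- The list gives a length-additive product of blocks. -/
def Good (n k : ℕ) : List ℕ → Prop
  | [] => True
  | M :: L => Good n k L ∧ M + k ≤ n ∧
      ∀ x y, IAdj (bprod n k L) x y → ¬ IAdj (revB n k M) (bprod n k L x) (bprod n k L y)

lemma card_bprod_le (L : List ℕ) (hL : ∀ M ∈ L, M + k ≤ n) :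
    (invD (bprod n k L)).card ≤ L.length * (k * (k - 1)) := by
  induction L with
  | nil => simp [bprod, invD_one]
  | cons M L ih =>
    have h1 := ih (fun N hN => hL N (by simp [hN]))
    have h2 := card_mul_le (revB n k M) (bprod n k L)
    rw [card_invD_revB (hL M (by simp))] at h2
    rw [bprod_cons, List.length_cons, add_mul, one_mul]
    omega

lemma good_of_card (L : List ℕ) (hL : ∀ M ∈ L, M + k ≤ n)
    (h : (invD (bprod n k L)).card = L.length * (k * (k - 1))) : Good n k L := by
  induction L with
  | nil => trivial
  | cons M L ih =>
    have hL' : ∀ N ∈ L, N + k ≤ n := fun N hN => hL N (by simp [hN])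
    have hM := hL M (by simp)
    have h1 := card_bprod_le L hL'
    have h2 := card_mul_le (revB n k M) (bprod n k L)
    rw [bprod_cons, List.length_cons, add_mul, one_mul] at h
    have h3 := card_invD_revB hM
    refine ⟨ih hL' (by omega), hM, ?_⟩
    rw [← card_mul_iff]
    omega

/-- Two blocks overlap in at most one point. -/
def Far (k a b : ℕ) : Prop := a + (k - 1) ≤ b ∨ b + (k - 1) ≤ a

lemma far_aux (hk : 3 ≤ k) (M : ℕ) (hMn : M + k ≤ n) (L : List ℕ) (hG : Good n k L)
    (hP : L.Pairwise (Far k))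
    (hM : M ∉ L) (hN : ∃ N ∈ L, ¬ Far k M N) :
    ∃ N ∈ L, ¬ Far k M N ∧ ∃ x y, (bprod n k L x).val = max M N ∧
      (bprod n k L y).val = max M N + 1 ∧ IAdj (bprod n k L) x y := by
  induction L with
  | nil => simp at hN
  | cons N L ih =>
    rw [List.pairwise_cons] at hP
    obtain ⟨hG1, hG2, hG3⟩ := hG
    rw [List.mem_cons, not_or] at hM
    by_cases hfar : Far k M N
    · obtain ⟨N', hN', hf', x, y, hx, hy, hxy⟩ := ih hG1 hP.2 hM.2 (by
        obtain ⟨N', h1, h2⟩ := hN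
        rcases List.mem_cons.1 h1 with h3 | h3
        · subst h3; exact absurd hfar h2
        · exact ⟨N', h3, h2⟩)
      have hMN' : M ≠ N' := fun h => hM.2 (h ▸ hN')
      have hNN' := hP.1 N' hN'
      unfold Far at *
      have ex : revB n k N (bprod n k L x) = bprod n k L x := by
        apply Fin.ext; rw [revB_val]; split_ifs <;> omega
      have ey : revB n k N (bprod n k L y) = bprod n k L y := by
        apply Fin.ext; rw [revB_val]; split_ifs <;> omega
      refine ⟨N', by simp [hN'], hf', x, y, ?_, ?_, ?_⟩
      · rw [bprod_cons, Perm.mul_apply, ex, hx]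
      · rw [bprod_cons, Perm.mul_apply, ey, hy]
      · unfold IAdj at hxy ⊢
        rw [bprod_cons, Perm.mul_apply, Perm.mul_apply, ex, ey]
        exact hxy
    · have hMN := hM.1
      refine ⟨N, by simp, hfar, ?_⟩
      unfold Far at hfar
      let a : Fin n := ⟨max M N, by omega⟩
      let b : Fin n := ⟨max M N + 1, by omega⟩
      let x := (bprod n k L).symm (revB n k N a)
      let y := (bprod n k L).symm (revB n k N b)
      have hx : bprod n k L x = revB n k N a := by simp [x]
      have hy : bprod n k L y = revB n k N b := by simp [y]
      have hab : a ≠ b := by simp [a, b, Fin.ext_iff]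
      have h1 : IAdj (revB n k N) (bprod n k L x) (bprod n k L y) := by
        rw [hx, hy, iadj_revB hG2]
        refine ⟨fun h => hab ((revB n k N).injective h), ?_, ?_⟩
        · rw [revB_val]; simp only [a]; split_ifs <;> omega
        · rw [revB_val]; simp only [b]; split_ifs <;> omega
      have h2 : ¬ IAdj (bprod n k L) x y := fun h => hG3 x y h h1
      refine ⟨x, y, ?_, ?_, ?_⟩
      · rw [bprod_cons, Perm.mul_apply, hx, revB_revB]
      · rw [bprod_cons, Perm.mul_apply, hy, revB_revB]
      · rw [bprod_cons, iadj_mul]; tauto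

lemma far_of_good (hk : 3 ≤ k) (L : List ℕ) (hG : Good n k L) (hL : L.Nodup) :
    L.Pairwise (Far k) := by
  induction L with
  | nil => simp
  | cons M L ih =>
    obtain ⟨hG1, hG2, hG3⟩ := hG
    rw [List.nodup_cons] at hL
    have hP := ih hG1 hL.2
    rw [List.pairwise_cons]
    refine ⟨?_, hP⟩
    by_contra hcon
    push Not at hcon
    obtain ⟨N, hN, hf, x, y, hx, hy, hxy⟩ := far_aux hk M hG2 L hG1 hP hL.1 hcon
    have hMN : M ≠ N := fun h => hL.1 (h ▸ hN)
    unfold Far at hf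
    apply hG3 x y hxy
    rw [iadj_revB hG2, ne_eq, Fin.ext_iff]
    omega

lemma revB_cases {M : ℕ} (h : M + k ≤ n) (x : Fin n) :
    ((M ≤ x.val ∧ x.val < M + k) ∧ (revB n k M x).val = 2 * M + k - 1 - x.val) ∨
    (¬ (M ≤ x.val ∧ x.val < M + k) ∧ (revB n k M x).val = x.val) := by
  rw [revB_val]
  split_ifs <;> omega

/-- Elements already involved in an inversion may only enter new blocks at an endpoint. -/
lemma endpoint_inv (hk : 3 ≤ k) (L : List ℕ) (hG : Good n k L) (hP : L.Pairwise (Far k)) :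
    ∀ M, (∀ N ∈ L, Far k M N) → ∀ x y, x < y → bprod n k L y < bprod n k L x →
      (M ≤ (bprod n k L x).val ∧ (bprod n k L x).val < M + k → (bprod n k L x).val = M) ∧
      (M ≤ (bprod n k L y).val ∧ (bprod n k L y).val < M + k →
        (bprod n k L y).val = M + k - 1) := by
  induction L with
  | nil =>
    intro M _ x y h1 h2
    simp [bprod] at h2
    exact absurd h1 (not_lt.2 h2.le)
  | cons N L ih =>
    obtain ⟨hG1, hG2, hG3⟩ := hG
    rw [List.pairwise_cons] at hP
    intro M hM x y hxy hwxy
    have hMN : Far k M N := hM N (by simp)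
    have ihM := ih hG1 hP.2 M (fun N' h => hM N' (by simp [h])) x y hxy
    have ihN := ih hG1 hP.2 N hP.1 x y hxy
    rw [bprod_cons, Perm.mul_apply, Perm.mul_apply] at *
    have cx := revB_cases hG2 (bprod n k L x)
    have cy := revB_cases hG2 (bprod n k L y)
    unfold Far at hMN
    rw [Fin.lt_def] at hwxy ihM ihN
    by_cases h : (bprod n k L y).val < (bprod n k L x).val
    · have h1 := ihM h
      have h2 := ihN h
      clear ihM ihN ih hM hP hG3
      omega
    · clear ihM ihN ih hM hP hG3
      omega

/-- The family of occurrences produced by the blocks. -/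
def famT (n k : ℕ) : List ℕ → List (Finset (Fin n))
  | [] => []
  | M :: L => (Finset.univ.filter (fun x => bprod n k L x ∈ blk n k M)) :: famT n k L

lemma length_famT (L : List ℕ) : (famT n k L).length = L.length := by
  induction L with
  | nil => rfl
  | cons M L ih => simp [famT, ih]

lemma famT_spec (hk : 3 ≤ k) (L : List ℕ) (hG : Good n k L) (hP : L.Pairwise (Far k)) :
    (∀ T ∈ famT n k L, T.card = k) ∧
    (∀ x y, IAdj (bprod n k L) x y ↔ x ≠ y ∧ ∃ T ∈ famT n k L, x ∈ T ∧ y ∈ T) ∧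
    ((famT n k L).Pairwise (fun T T' => ∀ x ∈ T, x ∈ T' → ∀ y ∈ T, y ∈ T' → x = y)) ∧
    (∀ x y z, x < y → y < z → bprod n k L y < bprod n k L x → bprod n k L z < bprod n k L y →
      ∃ T ∈ famT n k L, x ∈ T ∧ y ∈ T ∧ z ∈ T) := by
  induction L with
  | nil =>
    refine ⟨by simp [famT], by simp [famT, bprod, IAdj], by simp [famT], ?_⟩
    intro x y z h1 _ h2
    simp [bprod] at h2
    exact absurd h1 (not_lt.2 h2.le)
  | cons M L ih =>
    have hQ := endpoint_inv hk L hG.1 (List.pairwise_cons.1 hP).2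
    obtain ⟨hG1, hG2, hG3⟩ := hG
    rw [List.pairwise_cons] at hP
    obtain ⟨i1, i2, i3, i4⟩ := ih hG1 hP.2
    have hQM := hQ M hP.1
    set v := bprod n k L with hv
    let T0 : Finset (Fin n) := Finset.univ.filter (fun x => v x ∈ blk n k M)
    have hfam : famT n k (M :: L) = T0 :: famT n k L := rfl
    have hT0 : ∀ x, x ∈ T0 ↔ M ≤ (v x).val ∧ (v x).val < M + k := by
      intro x; simp [T0, mem_blk]
    have hadj0 : ∀ x y, IAdj (revB n k M) (v x) (v y) ↔ x ≠ y ∧ x ∈ T0 ∧ y ∈ T0 := by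
      intro x y; rw [iadj_revB hG2, hT0, hT0, ne_eq, v.injective.eq_iff]
    have hadj : ∀ x y, IAdj (bprod n k (M :: L)) x y ↔
        IAdj v x y ∨ (x ≠ y ∧ x ∈ T0 ∧ y ∈ T0) := by
      intro x y
      rw [bprod_cons, iadj_mul, ← hv, ← hadj0]
      have := hG3 x y
      tauto
    have hdisj : ∀ x y, IAdj v x y → ¬ (x ∈ T0 ∧ y ∈ T0) := by
      intro x y h h'
      exact hG3 x y h ((hadj0 x y).2 ⟨h.ne, h'⟩)
    have hltv : ∀ x y, x < y → x ∈ T0 → y ∈ T0 → v x < v y := by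
      intro x y h1 h2 h3
      by_contra h4
      have h5 : v y ≠ v x := fun h => h1.ne (v.injective h.symm)
      exact hdisj x y (iadj_of_lt h1 (lt_of_le_of_ne (not_lt.1 h4) h5)) ⟨h2, h3⟩
    rw [hfam]
    refine ⟨?_, ?_, ?_, ?_⟩
    · intro T hT
      rcases List.mem_cons.1 hT with rfl | hT
      · rw [← card_blk hG2]
        apply Finset.card_bij (fun x _ => v x)
        · intro x hx; simpa [T0] using hx
        · intro x _ y _ h; exact v.injective h
        · intro b hb; exact ⟨v.symm b, by simpa [T0] using hb, by simp⟩
      · exact i1 T hT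
    · intro x y
      rw [hadj, i2]
      simp only [List.mem_cons, exists_eq_or_imp]
      rw [← and_or_left, or_comm]
    · rw [List.pairwise_cons]
      refine ⟨?_, i3⟩
      intro T hT x hx hx' y hy hy'
      by_contra hne
      exact hdisj x y ((i2 x y).2 ⟨hne, T, hT, hx', hy'⟩) ⟨hx, hy⟩
    · intro x y z hxy hyz h1 h2
      have a1 := (hadj x y).1 (iadj_of_lt hxy h1)
      have a2 := (hadj y z).1 (iadj_of_lt hyz h2)
      have dir : ∀ p q, p < q → IAdj v p q → v q < v p := by
        intro p q hpq h
        rcases iadj_cases.1 h with h | h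
        · exact h.2
        · exact absurd hpq (not_lt.2 h.1.le)
      rcases a1 with a1 | ⟨_, b1, b2⟩ <;> rcases a2 with a2 | ⟨_, c1, c2⟩
      · obtain ⟨T, hT, h⟩ := i4 x y z hxy hyz (dir _ _ hxy a1) (dir _ _ hyz a2)
        exact ⟨T, by simp [hT], h⟩
      · exfalso
        have e := (hQM x y hxy (dir _ _ hxy a1)).2 ((hT0 y).1 c1)
        have f := hltv y z hyz c1 c2
        have g := (hT0 z).1 c2
        rw [Fin.lt_def] at f
        omega
      · exfalso
        have e := (hQM y z hyz (dir _ _ hyz a2)).1 ((hT0 y).1 b2)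
        have f := hltv x y hxy b1 b2
        have g := (hT0 x).1 b1
        rw [Fin.lt_def] at f
        omega
      · exact ⟨T0, by simp, b1, b2, c2⟩

lemma triple_fam (w : Perm (Fin n)) (P : Finset (Fin n) → Prop)
    (h : ∀ x y z, x < y → y < z → w y < w x → w z < w y → ∃ T, P T ∧ x ∈ T ∧ y ∈ T ∧ z ∈ T)
    (a b c : Fin n) (h1 : IAdj w a b) (h2 : IAdj w a c) (h3 : IAdj w b c) :
    ∃ T, P T ∧ a ∈ T ∧ b ∈ T ∧ c ∈ T := by
  rcases iadj_cases.1 h1 with h1 | h1 <;> rcases iadj_cases.1 h2 with h2 | h2 <;>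
    rcases iadj_cases.1 h3 with h3 | h3
  · obtain ⟨T, hT, r⟩ := h a b c h1.1 h3.1 h1.2 h3.2; exact ⟨T, hT, by tauto⟩
  · obtain ⟨T, hT, r⟩ := h a c b h2.1 h3.1 h2.2 h3.2; exact ⟨T, hT, by tauto⟩
  · exact absurd (h1.1.trans h3.1) (not_lt.2 h2.1.le)
  · obtain ⟨T, hT, r⟩ := h c a b h2.1 h1.1 h2.2 h1.2; exact ⟨T, hT, by tauto⟩
  · obtain ⟨T, hT, r⟩ := h b a c h1.1 h2.1 h1.2 h2.2; exact ⟨T, hT, by tauto⟩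
  · exact absurd (h1.1.trans h2.1) (not_lt.2 h3.1.le)
  · obtain ⟨T, hT, r⟩ := h b c a h3.1 h2.1 h3.2 h2.2; exact ⟨T, hT, by tauto⟩
  · obtain ⟨T, hT, r⟩ := h c b a h3.1 h1.1 h3.2 h1.2; exact ⟨T, hT, by tauto⟩

lemma backward (hk : 3 ≤ k) (L : List ℕ) (hG : Good n k L) (hP : L.Pairwise (Far k)) :
    EveryInvOnce n k (bprod n k L) ∧
    Nat.card {T : Finset (Fin n) // T.card = k ∧ DecrOn n (bprod n k L) T} = L.length := by
  obtain ⟨i1, i2, i3, i4⟩ := famT_spec hk L hG hP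
  set w := bprod n k L
  have hcl : ∀ T ∈ famT n k L, DecrOn n w T := by
    intro T hT
    rw [decrOn_iff]
    intro a ha b hb hab
    exact (i2 a b).2 ⟨hab, T, hT, ha, hb⟩
  have huniq : ∀ T ∈ famT n k L, ∀ T' ∈ famT n k L, ∀ x y, x ≠ y → x ∈ T → y ∈ T → x ∈ T' →
      y ∈ T' → T = T' := by
    intro T hT T' hT' x y hne h1 h2 h3 h4
    by_contra hTT
    have h5 : ∀ T ∈ famT n k L, ∀ T' ∈ famT n k L, T ≠ T' →
        ∀ x ∈ T, x ∈ T' → ∀ y ∈ T, y ∈ T' → x = y := by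
      have hs : Std.Symm (fun T T' : Finset (Fin n) => ∀ x ∈ T, x ∈ T' → ∀ y ∈ T, y ∈ T' → x = y) :=
        ⟨fun T T' h x hx hx' y hy hy' => h x hx' hx y hy' hy⟩
      intro T hT T' hT' hne
      exact i3.forall hT hT' hne
    exact hne (h5 T hT T' hT' hTT x h1 h3 y h2 h4)
  have hmem : ∀ S : Finset (Fin n), S.card = k → DecrOn n w S → ∀ x ∈ S, ∀ y ∈ S, x ≠ y →
      ∀ T ∈ famT n k L, x ∈ T → y ∈ T → S = T := by
    intro S hS hd x hx y hy hne T hT hxT hyT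
    rw [decrOn_iff] at hd
    apply Finset.eq_of_subset_of_card_le
    · intro c hc
      by_cases hcx : x = c
      · exact hcx ▸ hxT
      by_cases hcy : y = c
      · exact hcy ▸ hyT
      obtain ⟨T', hT', r⟩ := triple_fam w (fun T => T ∈ famT n k L) i4 x y c (hd x hx y hy hne)
        (hd x hx c hc hcx) (hd y hy c hc hcy)
      rw [huniq T hT T' hT' x y hne hxT hyT r.1 r.2.1]
      exact r.2.2
    · rw [hS, i1 T hT]
  constructor
  · rw [everyInvOnce_iff]
    intro x y hxy
    obtain ⟨hne, T, hT, hx, hy⟩ := (i2 x y).1 hxy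
    refine ⟨T, ⟨i1 T hT, hcl T hT, hx, hy⟩, ?_⟩
    rintro S ⟨h1, h2, h3, h4⟩
    exact hmem S h1 h2 x h3 y h4 hne T hT hx hy
  · have hnd : (famT n k L).Nodup := by
      apply List.Pairwise.imp_of_mem _ i3
      intro T T' hT _ h hTT
      subst hTT
      have h1 : 1 < T.card := by rw [i1 T hT]; omega
      obtain ⟨a, ha, b, hb, hab⟩ := Finset.one_lt_card.1 h1
      exact hab (h a ha ha b hb hb)
    have hset : ∀ T : Finset (Fin n), (T.card = k ∧ DecrOn n w T) ↔ T ∈ (famT n k L).toFinset := by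
      intro T
      rw [List.mem_toFinset]
      constructor
      · rintro ⟨h1, h2⟩
        have h3 : 1 < T.card := by omega
        obtain ⟨a, ha, b, hb, hab⟩ := Finset.one_lt_card.1 h3
        obtain ⟨_, T', hT', hx, hy⟩ := (i2 a b).1 ((decrOn_iff _ _).1 h2 a ha b hb hab)
        rw [hmem T h1 h2 a ha b hb hab T' hT' hx hy]
        exact hT'
      · intro h; exact ⟨i1 T h, hcl T h⟩
    rw [Nat.card_congr (Equiv.subtypeEquivRight hset), Nat.card_eq_fintype_card, Fintype.card_coe,
      List.toFinset_card_of_nodup hnd, length_famT]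

end Blocks

section Forward

open Equiv

variable {n k : ℕ}

/-- Strict order of the inversion poset. -/
def Prc (w : Perm (Fin n)) (x y : Fin n) : Prop := x < y ∧ w y < w x

lemma Prc.trans {w : Perm (Fin n)} {x y z : Fin n} (h : Prc w x y) (h' : Prc w y z) :
    Prc w x z := ⟨h.1.trans h'.1, h'.2.trans h.2⟩

lemma Prc.adj {w : Perm (Fin n)} {x y : Fin n} (h : Prc w x y) : IAdj w x y :=
  iadj_of_lt h.1 h.2

lemma DecrOn.prc {w : Perm (Fin n)} {T : Finset (Fin n)} (h : DecrOn n w T) {x y : Fin n}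
    (hx : x ∈ T) (hy : y ∈ T) (hxy : x < y) : Prc w x y := ⟨hxy, h x hx y hy hxy⟩

lemma DecrOn.mono {w : Perm (Fin n)} {S T : Finset (Fin n)} (h : DecrOn n w T) (hS : S ⊆ T) :
    DecrOn n w S := fun a ha b hb hab => h a (hS ha) b (hS hb) hab

lemma glue {w : Perm (Fin n)} {T T' : Finset (Fin n)} (h : DecrOn n w T) (h' : DecrOn n w T')
    {y : Fin n} (hy : y ∈ T) (hy' : y ∈ T') :
    DecrOn n w (T.filter (· ≤ y) ∪ T'.filter (y < ·)) := by
  intro a ha b hb hab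
  simp only [Finset.mem_union, Finset.mem_filter] at ha hb
  rcases ha with ⟨ha, ha2⟩ | ⟨ha, ha2⟩ <;> rcases hb with ⟨hb, hb2⟩ | ⟨hb, hb2⟩
  · exact h a ha b hb hab
  · rcases ha2.eq_or_lt with e | e
    · subst e; exact h' a hy' b hb hab
    · exact (h' y hy' b hb hb2).trans (h a ha y hy e)
  · exact absurd (hab.trans_le hb2) (not_lt.2 ha2.le)
  · exact h' a ha b hb hab

lemma card_glue (T T' : Finset (Fin n)) (y : Fin n) :
    (T.filter (· ≤ y) ∪ T'.filter (y < ·)).card =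
      (T.filter (· ≤ y)).card + (T'.filter (y < ·)).card := by
  apply Finset.card_union_of_disjoint
  rw [Finset.disjoint_left]
  intro a ha hb
  simp only [Finset.mem_filter] at ha hb
  exact absurd hb.2 (not_lt.2 ha.2)

lemma card_split (T : Finset (Fin n)) (y : Fin n) :
    (T.filter (· ≤ y)).card + (T.filter (y < ·)).card = T.card := by
  have := Finset.card_filter_add_card_filter_not (s := T) (fun x => x ≤ y)
  simpa only [not_le] using this

lemma uniq_of (w : Perm (Fin n)) (h : EveryInvOnce n k w) {T T' : Finset (Fin n)} {x y : Fin n}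
    (hxy : x ≠ y) (hT : T.card = k) (hd : DecrOn n w T) (hT' : T'.card = k) (hd' : DecrOn n w T')
    (h1 : x ∈ T) (h2 : y ∈ T) (h3 : x ∈ T') (h4 : y ∈ T') : T = T' :=
  ((everyInvOnce_iff k w).1 h x y ((decrOn_iff w T).1 hd x h1 y h2 hxy)).unique
    ⟨hT, hd, h1, h2⟩ ⟨hT', hd', h3, h4⟩

/-- A chain of three elements lies in one occurrence. -/
lemma triple (hk : 3 ≤ k) (w : Perm (Fin n)) (h : EveryInvOnce n k w) {x y z : Fin n}
    (hxy : Prc w x y) (hyz : Prc w y z) :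
    ∃ T : Finset (Fin n), T.card = k ∧ DecrOn n w T ∧ x ∈ T ∧ y ∈ T ∧ z ∈ T := by
  obtain ⟨T, ⟨hT, hd, hx, hy⟩, -⟩ := h x y hxy.1 hxy.2
  obtain ⟨T', ⟨hT', hd', hy', hz'⟩, -⟩ := h y z hyz.1 hyz.2
  suffices hTT : T = T' by
    subst hTT; exact ⟨T, hT, hd, hx, hy, hz'⟩
  have key : ∀ S : Finset (Fin n), DecrOn n w S → k ≤ S.card → ∀ a b c : Fin n,
      a ∈ S → b ∈ S → c ∈ S → ∃ S0 : Finset (Fin n), S0.card = k ∧ DecrOn n w S0 ∧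
        a ∈ S0 ∧ b ∈ S0 ∧ c ∈ S0 := by
    intro S hS hSk a b c ha hb hc
    have h3 : ({a, b, c} : Finset (Fin n)).card ≤ k := Finset.card_le_three.trans hk
    have hsub : ({a, b, c} : Finset (Fin n)) ⊆ S := by
      intro t ht
      simp only [Finset.mem_insert, Finset.mem_singleton] at ht
      rcases ht with rfl | rfl | rfl <;> assumption
    obtain ⟨S0, h4, h5, h6⟩ := Finset.exists_subsuperset_card_eq hsub h3 hSk
    exact ⟨S0, h6, hS.mono h5, h4 (by simp), h4 (by simp), h4 (by simp)⟩
  have c1 := card_split T y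
  have c2 := card_split T' y
  have c3 := card_glue T T' y
  have c4 := card_glue T' T y
  by_cases hU : k ≤ (T.filter (· ≤ y) ∪ T'.filter (y < ·)).card
  · obtain ⟨S0, s1, s2, s3, s4, s5⟩ := key _ (glue hd hd' hy hy') hU x y z
      (by simp [hx, hxy.1.le]) (by simp [hy]) (by simp [hz', hyz.1])
    rw [uniq_of w h hxy.1.ne hT hd s1 s2 hx hy s3 s4]
    exact uniq_of w h hyz.1.ne s1 s2 hT' hd' s4 s5 hy' hz'
  · have hV : k ≤ (T'.filter (· ≤ y) ∪ T.filter (y < ·)).card := by omega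
    have d1 : 1 < (T.filter (· ≤ y)).card :=
      Finset.one_lt_card.2 ⟨x, by simp [hx, hxy.1.le], y, by simp [hy], hxy.1.ne⟩
    have d2 : 0 < (T'.filter (y < ·)).card :=
      Finset.card_pos.2 ⟨z, by simp [hz', hyz.1]⟩
    have d3 : 1 < (T'.filter (· ≤ y)).card := by omega
    have d4 : 0 < (T.filter (y < ·)).card := by omega
    obtain ⟨z', hz2⟩ := Finset.card_pos.1 d4
    obtain ⟨x', hx2, hne⟩ := Finset.exists_mem_ne d3 y
    obtain ⟨S0, s1, s2, s3, s4, s5⟩ := key _ (glue hd' hd hy' hy) hV x' y z'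
      (Finset.mem_union_left _ hx2) (by simp [hy']) (Finset.mem_union_right _ hz2)
    rw [Finset.mem_filter] at hz2 hx2
    rw [uniq_of w h hz2.2.ne hT hd s1 s2 hy hz2.1 s4 s5]
    exact uniq_of w h hne s1 s2 hT' hd' s3 s4 hx2.1 hy'

lemma exists_top (w : Perm (Fin n)) (q : Fin n) :
    ∃ b, (q = b ∨ Prc w q b) ∧ ∀ z, ¬ Prc w b z := by
  classical
  obtain ⟨b, hb, hmax⟩ := Finset.exists_max_image
    (Finset.univ.filter (fun b => q = b ∨ Prc w q b)) (fun b => b) ⟨q, by simp⟩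
  simp only [Finset.mem_filter, Finset.mem_univ, true_and] at hb hmax
  refine ⟨b, hb, fun z hz => ?_⟩
  have := hmax z (by
    rcases hb with rfl | hb
    · exact Or.inr hz
    · exact Or.inr (hb.trans hz))
  exact absurd hz.1 (not_lt.2 this)

lemma exists_bot (w : Perm (Fin n)) (q : Fin n) :
    ∃ b, (b = q ∨ Prc w b q) ∧ ∀ z, ¬ Prc w z b := by
  classical
  obtain ⟨b, hb, hmax⟩ := Finset.exists_min_image
    (Finset.univ.filter (fun b => b = q ∨ Prc w b q)) (fun b => b) ⟨q, by simp⟩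
  simp only [Finset.mem_filter, Finset.mem_univ, true_and] at hb hmax
  refine ⟨b, hb, fun z hz => ?_⟩
  have := hmax z (by
    rcases hb with rfl | hb
    · exact Or.inr hz
    · exact Or.inr (hz.trans hb))
  exact absurd hz.1 (not_lt.2 this)

/-- There is a pair (minimal, maximal) of comparable elements with consecutive positions between. -/
lemma exists_full (w : Perm (Fin n)) (hne : ∃ x y, Prc w x y) :
    ∃ a b, Prc w a b ∧ (∀ z, ¬ Prc w z a) ∧ (∀ z, ¬ Prc w b z) ∧
      ∀ q, a < q → q < b → w b < w q ∧ w q < w a := by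
  classical
  let S : Finset (Fin n × Fin n) := Finset.univ.filter (fun p => Prc w p.1 p.2 ∧
    (∀ z, ¬ Prc w z p.1) ∧ (∀ z, ¬ Prc w p.2 z))
  have hS : S.Nonempty := by
    obtain ⟨x, y, hxy⟩ := hne
    obtain ⟨b, hb, hb'⟩ := exists_top w y
    obtain ⟨a, ha, ha'⟩ := exists_bot w x
    refine ⟨(a, b), ?_⟩
    simp only [S, Finset.mem_filter, Finset.mem_univ, true_and]
    refine ⟨?_, ha', hb'⟩
    have h1 : Prc w x b := by
      rcases hb with rfl | hb
      · exact hxy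
      · exact hxy.trans hb
    rcases ha with rfl | ha
    · exact h1
    · exact ha.trans h1
  obtain ⟨⟨a, b⟩, hab, hmin⟩ := Finset.exists_min_image S
    (fun p => p.2.val * (n + 1) + (n - p.1.val)) hS
  simp only [S, Finset.mem_filter, Finset.mem_univ, true_and, Prod.forall] at hab hmin
  obtain ⟨h1, h2, h3⟩ := hab
  refine ⟨a, b, h1, h2, h3, ?_⟩
  intro q hq1 hq2
  constructor
  · by_contra hcon
    have hwq : w q < w b := lt_of_le_of_ne (not_lt.1 hcon) (fun e => hq2.ne (w.injective e))
    have haq : Prc w a q := ⟨hq1, hwq.trans h1.2⟩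
    obtain ⟨b', hb, hb'⟩ := exists_top w q
    have hab' : Prc w a b' := by
      rcases hb with rfl | hb
      · exact haq
      · exact haq.trans hb
    have hwb : w b' < w b := by
      rcases hb with rfl | hb
      · exact hwq
      · exact hb.2.trans hwq
    have hlt : b' < b := by
      rcases lt_trichotomy b' b with h | h | h
      · exact h
      · subst h; exact absurd hwb (lt_irrefl _)
      · exact absurd ⟨h, hwb⟩ (h3 b')
    have := hmin a b' ⟨hab', h2, hb'⟩
    rw [Fin.lt_def] at hlt
    have : (b'.val + 1) * (n + 1) ≤ b.val * (n + 1) := Nat.mul_le_mul_right _ hlt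
    have ha := a.isLt
    rw [add_mul, one_mul] at this
    omega
  · by_contra hcon
    have hwq : w a < w q := lt_of_le_of_ne (not_lt.1 hcon) (fun e => hq1.ne (w.injective e))
    have hqb : Prc w q b := ⟨hq2, h1.2.trans hwq⟩
    obtain ⟨a', ha, ha'⟩ := exists_bot w q
    have hab' : Prc w a' b := by
      rcases ha with rfl | ha
      · exact hqb
      · exact ha.trans hqb
    have hwb : w a < w a' := by
      rcases ha with rfl | ha
      · exact hwq
      · exact hwq.trans ha.2
    have hlt : a < a' := by
      rcases lt_trichotomy a a' with h | h | h
      · exact h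
      · subst h; exact absurd hwb (lt_irrefl _)
      · exact absurd ⟨h, hwb⟩ (h2 a')
    have := hmin a' b ⟨hab', ha', h3⟩
    rw [Fin.lt_def] at hlt
    have ha := a'.isLt
    omega

lemma exists_block (hk : 3 ≤ k) (w : Perm (Fin n)) (h : EveryInvOnce n k w)
    (hne : ∃ x y, Prc w x y) : ∃ p, p + k ≤ n ∧ DecrOn n w (blk n k p) := by
  obtain ⟨a, b, hab, ha, hb, hq⟩ := exists_full w hne
  obtain ⟨T, ⟨hT, hd, haT, hbT⟩, -⟩ := h a b hab.1 hab.2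
  have hTeq : T = Finset.Icc a b := by
    ext c
    rw [Finset.mem_Icc]
    constructor
    · intro hc
      constructor
      · by_contra hcon
        exact ha c (hd.prc hc haT (not_le.1 hcon))
      · by_contra hcon
        exact hb c (hd.prc hbT hc (not_le.1 hcon))
    · rintro ⟨h1, h2⟩
      rcases h1.eq_or_lt with e | e
      · exact e ▸ haT
      rcases h2.eq_or_lt with e2 | e2
      · exact e2 ▸ hbT
      have hqc := hq c e e2
      obtain ⟨T', hT', hd', m1, m2, m3⟩ := triple hk w h (x := a) (y := c) (z := b)
        ⟨e, hqc.2⟩ ⟨e2, hqc.1⟩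
      rw [uniq_of w h hab.1.ne hT hd hT' hd' haT hbT m1 m3]
      exact m2
  have hcard : b.val + 1 - a.val = k := by
    rw [← hT, hTeq, Fin.card_Icc]
  refine ⟨a.val, by omega, ?_⟩
  apply hd.mono
  intro x hx
  rw [hTeq, Finset.mem_Icc, Fin.le_def, Fin.le_def]
  rw [mem_blk] at hx
  omega

/-- Some inversion crosses the gap `c`. -/
def Cross (w : Perm (Fin n)) (c : ℕ) : Prop :=
  ∃ x y : Fin n, x.val < c ∧ c ≤ y.val ∧ w y < w x

lemma everyInvOnce_step (w : Perm (Fin n)) (h : EveryInvOnce n k w)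
    {p : ℕ} (hp : p + k ≤ n) (hd : DecrOn n w (blk n k p)) :
    EveryInvOnce n k (w * revB n k p) := by
  obtain ⟨hadj, -⟩ := split_block w hp hd
  rw [everyInvOnce_iff]
  intro i j hij
  set b := revB n k p with hb
  have hbb : ∀ x, b (b x) = x := revB_revB n k p
  have h1 := (hadj (b i) (b j)).1 (by rw [hbb, hbb]; exact hij)
  obtain ⟨T, ⟨hT, hdT, hi, hj⟩, -⟩ := (everyInvOnce_iff k w).1 h _ _ h1.1
  have himg : ∀ (S : Finset (Fin n)) (x : Fin n), x ∈ S.image b ↔ b x ∈ S := by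
    intro S x
    rw [Finset.mem_image]
    constructor
    · rintro ⟨a, ha, rfl⟩; rw [hbb]; exact ha
    · intro hx; exact ⟨b x, hx, hbb x⟩
  have hci : ∀ S : Finset (Fin n), (S.image b).card = S.card :=
    fun S => Finset.card_image_of_injective S b.injective
  refine ⟨T.image b, ⟨by rw [hci, hT], ?_, (himg _ _).2 hi, (himg _ _).2 hj⟩, ?_⟩
  · rw [decrOn_iff]
    intro x hx y hy hxy
    rw [himg] at hx hy
    have hne : b x ≠ b y := fun e => hxy (b.injective e)
    have h2 := (hadj (b x) (b y)).2 ⟨(decrOn_iff w T).1 hdT _ hx _ hy hne, ?_⟩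
    · rwa [hbb, hbb] at h2
    · rintro ⟨h3, h4⟩
      have e : T = blk n k p := uniq_of w h hne hT hdT (card_blk hp) hd hx hy h3 h4
      exact h1.2 ⟨e ▸ hi, e ▸ hj⟩
  · rintro S ⟨s1, s2, s3, s4⟩
    have h3 : DecrOn n w (S.image b) := by
      rw [decrOn_iff] at s2 ⊢
      intro x hx y hy hxy
      rw [himg] at hx hy
      exact ((hadj x y).1 (s2 _ hx _ hy (fun e => hxy (b.injective e)))).1
    have h4 : S.image b = T := uniq_of w h (h1.1.ne) (by rw [hci, s1]) h3 hT hdT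
      ((himg _ _).2 (by rw [hbb]; exact s3)) ((himg _ _).2 (by rw [hbb]; exact s4)) hi hj
    rw [← h4]
    ext x
    rw [himg, himg, hbb]

lemma forward (hk : 3 ≤ k) (N : ℕ) : ∀ w : Perm (Fin n), (invD w).card = N → EveryInvOnce n k w →
    ∃ L : List ℕ, L.Nodup ∧ (∀ M ∈ L, M + k ≤ n) ∧ bprod n k L = w ∧
      (invD w).card = L.length * (k * (k - 1)) ∧
      ∀ M ∈ L, ∀ c, M < c → c < M + k → Cross w c := by
  induction N using Nat.strong_induction_on with
  | _ N ih =>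
    intro w hN h
    by_cases hne : ∃ x y, Prc w x y
    · obtain ⟨p, hp, hd⟩ := exists_block hk w h hne
      obtain ⟨hadj, hcard⟩ := split_block w hp hd
      have hstep := everyInvOnce_step w h hp hd
      have hpos : 0 < k * (k - 1) := Nat.mul_pos (by omega) (by omega)
      obtain ⟨L, l1, l2, l3, l4, l5⟩ := ih _ (by omega) (w * revB n k p) rfl hstep
      -- the point `p + 1` is isolated after removing the block
      let a : Fin n := ⟨p, by omega⟩
      let m : Fin n := ⟨p + 1, by omega⟩
      let z : Fin n := ⟨p + 2, by omega⟩
      have ham : a ∈ blk n k p := by simp [mem_blk, a]; omega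
      have hmm : m ∈ blk n k p := by simp [mem_blk, m]; omega
      have hzm : z ∈ blk n k p := by simp [mem_blk, z]; omega
      have pam : Prc w a m := hd.prc ham hmm (by simp [a, m])
      have pmz : Prc w m z := hd.prc hmm hzm (by simp [m, z])
      have hiso : ∀ x, ¬ IAdj (w * revB n k p) (revB n k p x) (revB n k p m) := by
        intro x hx
        obtain ⟨h1, h2⟩ := (hadj x m).1 hx
        apply h2
        refine ⟨?_, hmm⟩
        rcases iadj_cases.1 h1 with h3 | h3
        · obtain ⟨T, t1, t2, t3, t4, t5⟩ := triple hk w h (x := x) h3 pmz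
          rw [← uniq_of w h pmz.1.ne t1 t2 (card_blk hp) hd t4 t5 hmm hzm]
          exact t3
        · obtain ⟨T, t1, t2, t3, t4, t5⟩ := triple hk w h (z := x) pam h3
          rw [← uniq_of w h pam.1.ne t1 t2 (card_blk hp) hd t3 t4 ham hmm]
          exact t5
      have hpL : p ∉ L := by
        intro hpL
        obtain ⟨x, y, h1, h2, h3⟩ := l5 p hpL (p + k - 2) (by omega) (by omega)
        set u := revB n k p m with hu
        have huv : u.val = p + k - 2 := by
          rw [hu, revB_val]; simp only [m]; split_ifs <;> omega
        have i1 := hiso (revB n k p x)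
        have i2 := hiso (revB n k p y)
        rw [revB_revB] at i1 i2
        unfold IAdj at i1 i2
        rw [not_not] at i1 i2
        have j1 := i1.1 (by rw [Fin.lt_def]; omega)
        have j2 : ¬ (w * revB n k p) y < (w * revB n k p) u := by
          rw [← i2, Fin.lt_def]; omega
        exact j2 (h3.trans j1)
      have hcrossp : ∀ c, p < c → c < p + k → Cross w c := by
        intro c h1 h2
        refine ⟨⟨c - 1, by omega⟩, ⟨c, by omega⟩, by simp; omega, by simp, ?_⟩
        apply hd
        · rw [mem_blk]; simp; omega
        · rw [mem_blk]; simp; omega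
        · rw [Fin.lt_def]; simp; omega
      refine ⟨L ++ [p], ?_, ?_, ?_, ?_, ?_⟩
      · rw [List.nodup_append]
        refine ⟨l1, by simp, ?_⟩
        intro x hx y hy
        rw [List.mem_singleton] at hy
        rintro rfl
        exact hpL (hy ▸ hx)
      · intro M hM
        rw [List.mem_append, List.mem_singleton] at hM
        rcases hM with hM | rfl
        · exact l2 M hM
        · exact hp
      · have e : bprod n k [p] = revB n k p := by simp [bprod]
        rw [bprod_append, l3, e, mul_assoc, revB_mul_self, mul_one]
      · rw [hcard, l4, List.length_append, List.length_singleton, add_mul, one_mul]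
      · intro M hM c h1 h2
        by_cases hc : p < c ∧ c < p + k
        · exact hcrossp c hc.1 hc.2
        rw [List.mem_append, List.mem_singleton] at hM
        rcases hM with hM | rfl
        · obtain ⟨x, y, h3, h4, h5⟩ := l5 M hM c h1 h2
          refine ⟨revB n k p x, revB n k p y, ?_, ?_, h5⟩
          · rw [revB_val]; split_ifs <;> omega
          · rw [revB_val]; split_ifs <;> omega
        · exact absurd ⟨h1, h2⟩ hc
    · have hw : w = 1 := by
        apply eq_one_of_no_adj
        intro x y hxy
        rcases iadj_cases.1 hxy with h1 | h1
        · exact hne ⟨x, y, h1⟩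
        · exact hne ⟨y, x, h1⟩
      refine ⟨[], by simp, by simp, by simp [bprod, hw], by simp [hw, invD_one], by simp⟩

lemma main_aux (hk : 3 ≤ k) (w : Perm (Fin n)) (j : List ℕ) (r : ℕ) (M : Fin r → ℕ)
    (hj : ReducedA k j (w0 k)) (hM : Function.Injective M)
    (hw : ReducedA n (List.ofFn (fun i => shift (M i) j)).flatten w) :
    EveryInvOnce n k w ∧ (∀ i i' : Fin r, i ≠ i' → k - 1 ≤ Nat.dist (M i) (M i')) ∧
        Nat.card {T : Finset (Fin n) // T.card = k ∧ DecrOn n w T} = r := by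
  have e : List.ofFn (fun i => shift (M i) j) = (List.ofFn M).map (fun N => shift N j) := by
    rw [List.map_ofFn]; rfl
  rw [e, reduced_flatten hk hj] at hw
  obtain ⟨h1, h2, h3⟩ := hw
  subst h2
  have hG := good_of_card _ h1 h3
  have hP := far_of_good hk _ hG (List.nodup_ofFn.2 hM)
  obtain ⟨b1, b2⟩ := backward hk _ hG hP
  refine ⟨b1, ?_, ?_⟩
  · intro i i' hii
    rw [List.pairwise_ofFn] at hP
    unfold Nat.dist
    rcases lt_or_gt_of_ne hii with h | h
    · have := hP h
      unfold Far at this; omega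
    · have := hP h
      unfold Far at this; omega
  · rw [b2, List.length_ofFn]

end Forward

theorem stmt10 (n k : ℕ) (hk : 3 ≤ k) (w : Equiv.Perm (Fin n)) :
    (EveryInvOnce n k w ↔
      ∃ (j : List ℕ) (r : ℕ) (M : Fin r → ℕ), ReducedA k j (w0 k) ∧
        Function.Injective M ∧
        ReducedA n (List.ofFn (fun i => shift (M i) j)).flatten w) ∧
    (∀ (j : List ℕ) (r : ℕ) (M : Fin r → ℕ), ReducedA k j (w0 k) →
      Function.Injective M →
      ReducedA n (List.ofFn (fun i => shift (M i) j)).flatten w →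
      ((∀ i i' : Fin r, i ≠ i' → k - 1 ≤ Nat.dist (M i) (M i')) ∧
        Nat.card {T : Finset (Fin n) // T.card = k ∧ DecrOn n w T} = r)) := by
  constructor
  · constructor
    · intro h
      obtain ⟨L, l1, l2, l3, l4, -⟩ := forward hk _ w rfl h
      obtain ⟨j, hj⟩ := exists_word _ (w0 k) rfl
      have hj' := (reducedA_iff j (w0 k)).2 hj
      refine ⟨j, L.length, L.get, hj', List.nodup_iff_injective_get.1 l1, ?_⟩
      have e : List.ofFn (fun i => shift (L.get i) j) = L.map (fun N => shift N j) := by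
        conv_rhs => rw [← List.ofFn_get L]
        rw [List.map_ofFn]; rfl
      rw [e, reduced_flatten hk hj']
      exact ⟨l2, l3, l4⟩
    · rintro ⟨j, r, M, hj, hM, hw⟩
      exact (main_aux hk w j r M hj hM hw).1
  · intro j r M hj hM hw
    exact (main_aux hk w j r M hj hM hw).2

end Paper
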